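/- Let W ⊆ Sym(n,ℝ) be a nontrivial linear subspace, and let A ∈ W have maximal rank r among the elements of W, with r ≥ 3. Assume there exists a point z ∈ ∂Γ_A with Az ≠ 0. Then there exists δ > 0 such that for every B ∈ W with ‖B − A‖ < δ the following holds: if there exists a point z' ∈ ∂Γ_B with Bz' ≠ 0, and if at every point z ∈ ∂Γ_A ∩ ∂Γ_B the vectors Az and Bz are linearly dependent, then Γ_A ⊆ Γ_B or Γ_B ⊆ Γ_A. -/

import Mathlib

open Matrix

/-! ### Real polynomials in one variable -/

lemma exists_nonneg_root_of_nonpos_of_pos {a m p : ℝ} (ha : a ≤ 0) (hp : 0 < p) :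
    ∃ t : ℝ, 0 ≤ t ∧ a + 2 * t * m + t ^ 2 * p = 0 := by
  have hd : 0 ≤ m ^ 2 - a * p := by nlinarith [sq_nonneg m, mul_nonneg (neg_nonneg.2 ha) hp.le]
  have hs := Real.sq_sqrt hd
  refine ⟨(-m + √(m ^ 2 - a * p)) / p, div_nonneg ?_ hp.le, ?_⟩
  · have : |m| ≤ √(m ^ 2 - a * p) :=
      Real.abs_le_sqrt (by nlinarith [mul_nonneg (neg_nonneg.2 ha) hp.le])
    linarith [le_abs_self m]
  · field_simp
    linear_combination hs

lemma exists_pos_root_of_neg_of_pos {a m p : ℝ} (ha : a < 0) (hp : 0 < p) :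
    ∃ t : ℝ, 0 < t ∧ a + 2 * t * m + t ^ 2 * p = 0 := by
  obtain ⟨t, ht, h⟩ := exists_nonneg_root_of_nonpos_of_pos (m := m) ha.le hp
  refine ⟨t, ht.lt_of_ne ?_, h⟩
  rintro rfl
  simp at h
  exact ha.ne h

lemma eventually_quadratic_pos {a : ℝ} (m p : ℝ) (ha : 0 < a) :
    ∀ᶠ t : ℝ in nhdsWithin 0 (Set.Ioi 0), 0 < a + 2 * t * m + t ^ 2 * p := by
  have hc : Continuous fun t : ℝ => a + 2 * t * m + t ^ 2 * p := by fun_prop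
  exact nhdsWithin_le_nhds ((hc.tendsto 0).eventually (lt_mem_nhds (by simpa using ha)))

lemma exists_pos_root_quartic {b₀ b₄ : ℝ} (b₁ b₂ b₃ : ℝ) (h₀ : 0 < b₀) (h₄ : b₄ < 0) :
    ∃ t : ℝ, 0 < t ∧ b₀ + b₁ * t + b₂ * t ^ 2 + b₃ * t ^ 3 + b₄ * t ^ 4 = 0 := by
  set f : ℝ → ℝ := fun t => b₀ + b₁ * t + b₂ * t ^ 2 + b₃ * t ^ 3 + b₄ * t ^ 4 with hf
  set S := b₀ + |b₁| + |b₂| + |b₃| with hS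
  have hS0 : 0 ≤ S := by positivity
  set T := 1 + S / (-b₄) with hT
  have hT1 : 1 ≤ T := by
    have : 0 ≤ S / (-b₄) := div_nonneg hS0 (by linarith)
    linarith
  have hbT : b₄ * T = b₄ - S := by
    have := h₄.ne
    rw [hT]
    field_simp
    ring
  have hT0 : 0 < T := by linarith
  have h3 : 1 ≤ T ^ 3 := one_le_pow₀ hT1
  have h32 : T ^ 2 ≤ T ^ 3 := pow_le_pow_right₀ hT1 (by norm_num)
  have h31 : T ≤ T ^ 3 := le_self_pow₀ hT1 (by norm_num)
  have hfT : f T ≤ 0 := by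
    have e0 : b₀ ≤ b₀ * T ^ 3 := le_mul_of_one_le_right h₀.le h3
    have e1 : b₁ * T ≤ |b₁| * T ^ 3 :=
      mul_le_mul (le_abs_self _) h31 hT0.le (abs_nonneg _)
    have e2 : b₂ * T ^ 2 ≤ |b₂| * T ^ 3 :=
      mul_le_mul (le_abs_self _) h32 (by positivity) (abs_nonneg _)
    have e3 : b₃ * T ^ 3 ≤ |b₃| * T ^ 3 :=
      mul_le_mul_of_nonneg_right (le_abs_self _) (by positivity)
    have e4 : b₄ * T ^ 4 = (b₄ - S) * T ^ 3 := by rw [← hbT]; ring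
    have e5 : b₄ * T ^ 3 ≤ 0 := mul_nonpos_of_nonpos_of_nonneg h₄.le (by positivity)
    simp only [hf]
    rw [e4, hS]
    linarith
  have hcont : ContinuousOn f (Set.Icc 0 T) := by
    apply Continuous.continuousOn
    fun_prop
  obtain ⟨t, ht, hft⟩ := intermediate_value_Icc' hT0.le hcont
    (show (0 : ℝ) ∈ Set.Icc (f T) (f 0) from ⟨hfT, by simpa [hf] using h₀.le⟩)
  refine ⟨t, ht.1.lt_of_ne ?_, hft⟩
  rintro rfl
  simp [hf] at hft
  linarith

/-- A quartic with positive constant term and negative leading coefficient has a simple root. -/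
lemma exists_simple_root_quartic {b₀ b₄ : ℝ} (b₁ b₂ b₃ : ℝ) (h₀ : 0 < b₀) (h₄ : b₄ < 0) :
    ∃ t : ℝ, b₀ + b₁ * t + b₂ * t ^ 2 + b₃ * t ^ 3 + b₄ * t ^ 4 = 0 ∧
      b₁ + 2 * b₂ * t + 3 * b₃ * t ^ 2 + 4 * b₄ * t ^ 3 ≠ 0 := by
  by_contra! H
  obtain ⟨t, ht, h1⟩ := exists_pos_root_quartic b₁ b₂ b₃ h₀ h₄
  obtain ⟨s', hs', h2'⟩ := exists_pos_root_quartic (-b₁) b₂ (-b₃) h₀ h₄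
  obtain ⟨s, rfl⟩ : ∃ s, s' = -s := ⟨-s', by ring⟩
  have h2 : b₀ + b₁ * s + b₂ * s ^ 2 + b₃ * s ^ 3 + b₄ * s ^ 4 = 0 := by
    linear_combination h2'
  have h1' := H t h1
  have h2'' := H s h2
  have hst : s - t ≠ 0 := by linarith
  -- divide the quartic by `(X - t) ^ 2`
  obtain ⟨m, hm⟩ : ∃ m, m = b₃ + 2 * t * b₄ := ⟨_, rfl⟩
  obtain ⟨k, hk⟩ : ∃ k, k = b₂ + 2 * t * m - t ^ 2 * b₄ := ⟨_, rfl⟩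
  have e3 : b₃ = m - 2 * t * b₄ := by linarith
  have e2 : b₂ = k - 2 * t * m + t ^ 2 * b₄ := by linarith
  subst e3 e2
  have e1 : b₁ = m * t ^ 2 - 2 * t * k := by linear_combination h1'
  subst e1
  have e0 : b₀ = k * t ^ 2 := by linear_combination h1
  subst e0
  have q : b₄ * s ^ 2 + m * s + k = 0 := by
    have : (s - t) ^ 2 * (b₄ * s ^ 2 + m * s + k) = 0 := by linear_combination h2
    exact (mul_eq_zero.1 this).resolve_left (pow_ne_zero _ hst)
  have q' : 2 * b₄ * s + m = 0 := by
    have : (s - t) ^ 2 * (2 * b₄ * s + m) = 0 := by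
      linear_combination h2'' - 2 * (s - t) * q
    exact (mul_eq_zero.1 this).resolve_left (pow_ne_zero _ hst)
  have hk' : k = b₄ * s ^ 2 := by linear_combination q - s * q'
  have : k * t ^ 2 ≤ 0 := by
    rw [hk']
    exact mul_nonpos_of_nonpos_of_nonneg
      (mul_nonpos_of_nonpos_of_nonneg h₄.le (sq_nonneg _)) (sq_nonneg _)
  linarith

/-! ### Pairs of symmetric bilinear forms without transversal common zeros -/

section BilinForm

variable {V : Type*} [AddCommGroup V] [Module ℝ V]

/-- At every common isotropic vector `v` of `A` and `B`, the functionals `A v` and `B v` are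
linearly dependent. -/
def NoTransversalZero (A B : LinearMap.BilinForm ℝ V) : Prop :=
  ∀ v, A v v = 0 → B v v = 0 → ¬ LinearIndependent ℝ ![A v, B v]

lemma bilinForm_add_smul_self {A : LinearMap.BilinForm ℝ V} (hA : A.IsSymm) (x y : V) (t : ℝ) :
    A (x + t • y) (x + t • y) = A x x + 2 * t * A x y + t ^ 2 * A y y := by
  have := hA.eq x y
  simp only [map_add, map_smul, LinearMap.add_apply, LinearMap.smul_apply, smul_eq_mul]
  rw [← this]
  ring

lemma NoTransversalZero.exists_relation {A B : LinearMap.BilinForm ℝ V}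
    (h : NoTransversalZero A B) {v : V} (hAv : A v v = 0) (hBv : B v v = 0) :
    ∃ α β : ℝ, (α = 0 → β ≠ 0) ∧ ∀ y, α * A v y + β * B v y = 0 := by
  have := h v hAv hBv
  rw [LinearIndependent.pair_iff] at this
  push Not at this
  obtain ⟨α, β, h, h'⟩ := this
  refine ⟨α, β, h', fun y => ?_⟩
  simpa using LinearMap.congr_fun h y

lemma exists_isotropic_pos {A B : LinearMap.BilinForm ℝ V} (hA : A.IsSymm) (hB : B.IsSymm)
    {x y : V} (hAx : A x x ≤ 0) (hAy : 0 < A y y) (hBx : 0 < B x x) (hBy : 0 ≤ B y y) :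
    ∃ z, A z z = 0 ∧ 0 < B z z := by
  wlog hxy : 0 ≤ B x y generalizing y
  · refine this (y := -y) (by simpa using hAy) (by simpa using hBy) ?_
    simp only [map_neg]
    linarith
  obtain ⟨t, ht, hr⟩ := exists_nonneg_root_of_nonpos_of_pos (m := A x y) hAx hAy
  refine ⟨x + t • y, by rw [bilinForm_add_smul_self hA, hr], ?_⟩
  rw [bilinForm_add_smul_self hB]
  positivity

lemma NoTransversalZero.exists_pos_apply_add_smul_eq_zero {A B : LinearMap.BilinForm ℝ V}
    (h : NoTransversalZero A B) (hA : A.IsSymm) (hB : B.IsSymm) {z z' : V}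
    (hz : A z z = 0) (hz' : A z' z' = 0) (hzz' : A z z' = 0)
    (hBz : 0 < B z z) (hBz' : B z' z' < 0) :
    ∃ t : ℝ, 0 < t ∧ ∀ y, A (z + t • z') y = 0 := by
  obtain ⟨t, ht, hr⟩ := exists_pos_root_of_neg_of_pos (a := - B z z) (m := - B z z')
    (p := - B z' z') (by linarith) (by linarith)
  refine ⟨t, ht, ?_⟩
  have hAv : A (z + t • z') (z + t • z') = 0 := by
    rw [bilinForm_add_smul_self hA, hz, hz', hzz']
    ring
  have hBv : B (z + t • z') (z + t • z') = 0 := by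
    rw [bilinForm_add_smul_self hB]
    linarith
  obtain ⟨α, β, hαβ, hrel⟩ := h.exists_relation hAv hBv
  have hβ : β = 0 := by
    have h1 := hrel z
    have hs := hB.eq z z'
    have hs' := hA.eq z z'
    simp only [map_add, map_smul, LinearMap.add_apply, LinearMap.smul_apply, smul_eq_mul,
      ← hs, ← hs', hz, hzz'] at h1
    have hne : B z z + t * B z z' ≠ 0 := by
      have : t ^ 2 * B z' z' < 0 := mul_neg_of_pos_of_neg (by positivity) hBz'
      intro h0
      nlinarith
    have : β * (B z z + t * B z z') = 0 := by linear_combination h1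
    exact (mul_eq_zero.1 this).resolve_right hne
  have hα : α ≠ 0 := fun h0 => hαβ h0 hβ
  intro y
  have := hrel y
  rw [hβ, zero_mul, add_zero] at this
  exact (mul_eq_zero.1 this).resolve_left hα

lemma exists_isotropic_pair {A : LinearMap.BilinForm ℝ V} (hA : A.IsSymm) {w w' : V}
    (hw : A w w < 0) (hw' : 0 < A w' w') :
    ∃ u u', A u u = 0 ∧ A u' u' = 0 ∧ A u u' ≠ 0 := by
  obtain ⟨t, ht, hr⟩ := exists_pos_root_of_neg_of_pos (m := A w w') hw hw'
  obtain ⟨s, hs, hr'⟩ := exists_pos_root_of_neg_of_pos (m := - A w w') hw hw'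
  refine ⟨w + t • w', w + (-s) • w', by rw [bilinForm_add_smul_self hA, hr], ?_, ?_⟩
  · rw [bilinForm_add_smul_self hA]
    linear_combination hr'
  · have hsym := hA.eq w w'
    simp only [map_add, map_smul, LinearMap.add_apply, LinearMap.smul_apply, smul_eq_mul, ← hsym]
    have hm : 2 * A w w' + (t - s) * A w' w' = 0 := by
      have : (t + s) * (2 * A w w' + (t - s) * A w' w') = 0 := by
        linear_combination hr - hr'
      exact (mul_eq_zero.1 this).resolve_left (by positivity)
    have : 0 < A w' w' * (t + s) ^ 2 := by positivity
    intro h0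
    nlinarith

/-- The isotropic vectors of an indefinite form `A` on which `B` has opposite signs can be chosen
not `A`-orthogonal to each other. -/
lemma NoTransversalZero.exists_isotropic_pair {A B : LinearMap.BilinForm ℝ V}
    (h : NoTransversalZero A B) (hA : A.IsSymm) (hB : B.IsSymm) {w w' z z' : V}
    (hw : A w w < 0) (hw' : 0 < A w' w') (hz : A z z = 0) (hz' : A z' z' = 0)
    (hBz : 0 < B z z) (hBz' : B z' z' < 0) :
    ∃ z z', A z z = 0 ∧ A z' z' = 0 ∧ A z z' ≠ 0 ∧ 0 < B z z ∧ B z' z' < 0 := by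
  by_cases hzz' : A z z' = 0
  swap
  · exact ⟨z, z', hz, hz', hzz', hBz, hBz'⟩
  obtain ⟨t, ht, h1⟩ := h.exists_pos_apply_add_smul_eq_zero hA hB hz hz' hzz' hBz hBz'
  obtain ⟨s, hs, h2⟩ := h.exists_pos_apply_add_smul_eq_zero hA hB (z' := -z') hz
    (by simpa using hz') (by simpa using hzz') hBz (by simpa using hBz')
  simp only [map_add, map_smul, map_neg, LinearMap.add_apply, LinearMap.smul_apply,
    LinearMap.neg_apply, smul_eq_mul] at h1 h2
  have hker' : ∀ y, A z' y = 0 := fun y => by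
    have : (t + s) * A z' y = 0 := by linear_combination h1 y - h2 y
    exact (mul_eq_zero.1 this).resolve_left (by positivity)
  have hker : ∀ y, A z y = 0 := fun y => by simpa [hker'] using h1 y
  obtain ⟨u, u', hu, hu', huu'⟩ := _root_.exists_isotropic_pair hA hw hw'
  obtain ⟨ε, ⟨h3, h4⟩, hε⟩ := (((eventually_quadratic_pos (B z u) (B u u) hBz).and
    (eventually_quadratic_pos (- B z' u') (- B u' u') (neg_pos.2 hBz'))).and
      self_mem_nhdsWithin).exists
  have hε : 0 < ε := hε
  refine ⟨z + ε • u, z' + ε • u', ?_, ?_, ?_, ?_, ?_⟩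
  · rw [bilinForm_add_smul_self hA, hker, hker, hu]
    ring
  · rw [bilinForm_add_smul_self hA, hker', hker', hu']
    ring
  · have hs := hA.eq u z'
    simp only [hker'] at hs
    simp [hker, hs, hε.ne', huu']
  · rwa [bilinForm_add_smul_self hB]
  · rw [bilinForm_add_smul_self hB]
    linarith

/-- The isotropic cone of `A` in the span of `z, z', k` is a nondegenerate conic, along which `B`
is a quartic polynomial all of whose roots are multiple. -/
lemma NoTransversalZero.apply_self_eq_zero_of_orthogonal {A B : LinearMap.BilinForm ℝ V}
    (h : NoTransversalZero A B) (hA : A.IsSymm) (hB : B.IsSymm) {z z' k : V}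
    (hz : A z z = 0) (hz' : A z' z' = 0) (hzz' : A z z' ≠ 0)
    (hBz : 0 < B z z) (hBz' : B z' z' < 0) (hk : A z k = 0) (hk' : A z' k = 0) :
    A k k = 0 := by
  by_contra hc
  wlog hn : 2 * A z z' = - A k k generalizing z
  · refine this (z := (- A k k / (2 * A z z')) • z) ?_ ?_ ?_ ?_ ?_
    · simp [hz]
    · simp [hzz', hc]
    · have : - A k k / (2 * A z z') ≠ 0 := div_ne_zero (neg_ne_zero.2 hc) (by simpa using hzz')
      simp only [map_smul, LinearMap.smul_apply, smul_eq_mul, ← mul_assoc]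
      exact mul_pos (mul_self_pos.2 this) hBz
    · simp [hk]
    · simp only [map_smul, LinearMap.smul_apply, smul_eq_mul]
      field_simp
  obtain ⟨t, hroot, hsimple⟩ := exists_simple_root_quartic (2 * B z k) (2 * B z z' + B k k)
    (2 * B z' k) hBz hBz'
  have sA := hA.eq
  have sB := hB.eq
  have hAv : A (z + t ^ 2 • z' + t • k) (z + t ^ 2 • z' + t • k) = 0 := by
    simp only [map_add, map_smul, LinearMap.add_apply, LinearMap.smul_apply, smul_eq_mul,
      ← sA z z', ← sA z k, ← sA z' k, hz, hz', hk, hk']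
    linear_combination t ^ 2 * hn
  have hBv : B (z + t ^ 2 • z' + t • k) (z + t ^ 2 • z' + t • k) = 0 := by
    simp only [map_add, map_smul, LinearMap.add_apply, LinearMap.smul_apply, smul_eq_mul,
      ← sB z z', ← sB z k, ← sB z' k]
    linear_combination hroot
  obtain ⟨α, β, hαβ, hrel⟩ := h.exists_relation hAv hBv
  have hβ : β = 0 := by
    have h1 := hrel ((2 * t) • z' + k)
    simp only [map_add, map_smul, LinearMap.add_apply, LinearMap.smul_apply, smul_eq_mul,
      ← sA z' k, ← sB z' k, hz', hk, hk'] at h1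
    refine (mul_eq_zero.1 ?_).resolve_right hsimple
    linear_combination 2 * h1 - 2 * α * t * hn
  have h2 := hrel z'
  simp only [map_add, map_smul, LinearMap.add_apply, LinearMap.smul_apply, smul_eq_mul,
    ← sA z' k, hz', hk', hβ] at h2
  refine hαβ ?_ hβ
  refine (mul_eq_zero.1 ?_).resolve_right hzz'
  linear_combination h2

lemma NoTransversalZero.finrank_range_le_two {A B : LinearMap.BilinForm ℝ V}
    (h : NoTransversalZero A B) (hA : A.IsSymm) (hB : B.IsSymm) {z z' : V}
    (hz : A z z = 0) (hz' : A z' z' = 0) (hzz' : A z z' ≠ 0)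
    (hBz : 0 < B z z) (hBz' : B z' z' < 0) :
    Module.finrank ℝ (LinearMap.range A) ≤ 2 := by
  have sA := hA.eq
  have hdiag : ∀ k, A z k = 0 → A z' k = 0 → A k k = 0 := fun k =>
    h.apply_self_eq_zero_of_orthogonal hA hB hz hz' hzz' hBz hBz'
  have horth : ∀ k l, A z k = 0 → A z' k = 0 → A z l = 0 → A z' l = 0 → A k l = 0 := by
    intro k l hk hk' hl hl'
    have h1 := hdiag (k + (1 : ℝ) • l) (by simp [hk, hl]) (by simp [hk', hl'])
    rw [bilinForm_add_smul_self hA, hdiag k hk hk', hdiag l hl hl'] at h1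
    linarith
  -- the component of `u` orthogonal to `z` and `z'`
  let q : V → V := fun u => u - (A z' u / A z z') • z - (A z u / A z z') • z'
  have hq : ∀ u, A z (q u) = 0 := fun u => by
    simp only [q, map_sub, map_smul, smul_eq_mul, hz]
    field_simp
    ring
  have hq' : ∀ u, A z' (q u) = 0 := fun u => by
    simp only [q, map_sub, map_smul, smul_eq_mul, hz', ← sA z z']
    field_simp
    ring
  have hzero : ∀ u, A (q u) = 0 := fun u => by
    ext y
    have hy : y = q y + (A z' y / A z z') • z + (A z y / A z z') • z' := by
      simp only [q]
      abel
    rw [LinearMap.zero_apply, hy, map_add, map_add, map_smul, map_smul, sA (q u) z, sA (q u) z',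
      hq, hq', horth (q u) (q y) (hq u) (hq' u) (hq y) (hq' y)]
    simp
  have hle : LinearMap.range A ≤ Submodule.span ℝ (Set.range ![A z, A z']) := by
    rintro _ ⟨u, rfl⟩
    have hu : A u = (A z' u / A z z') • A z + (A z u / A z z') • A z' := by
      have := hzero u
      simp only [q, map_sub, map_smul] at this
      rw [sub_sub, sub_eq_zero] at this
      exact this
    rw [hu]
    exact add_mem (Submodule.smul_mem _ _ (Submodule.subset_span ⟨0, rfl⟩))
      (Submodule.smul_mem _ _ (Submodule.subset_span ⟨1, rfl⟩))
  have : FiniteDimensional ℝ (Submodule.span ℝ (Set.range ![A z, A z'])) :=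
    FiniteDimensional.span_of_finite ℝ (Set.finite_range _)
  exact (Submodule.finrank_mono hle).trans ((finrank_range_le_card _).trans (by simp))

end BilinForm

/-! ### Quadratic cones -/

section Cone

variable {n : ℕ}

lemma continuous_dotProduct_mulVec_self (A : Matrix (Fin n) (Fin n) ℝ) :
    Continuous fun x : Fin n → ℝ => x ⬝ᵥ A.mulVec x := by
  fun_prop

lemma isSymm_toBilin' {A : Matrix (Fin n) (Fin n) ℝ} (hA : A.IsSymm) :
    (Matrix.toBilin' A).IsSymm := by
  refine ⟨fun x y => ?_⟩
  simp only [Matrix.toBilin'_apply']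
  rw [dotProduct_mulVec, ← mulVec_transpose, hA.eq, dotProduct_comm]

lemma linearIndependent_mulVec_of_toBilin' {A B : Matrix (Fin n) (Fin n) ℝ} (hA : A.IsSymm)
    (hB : B.IsSymm) {z : Fin n → ℝ}
    (h : LinearIndependent ℝ ![Matrix.toBilin' A z, Matrix.toBilin' B z]) :
    LinearIndependent ℝ ![A.mulVec z, B.mulVec z] := by
  rw [LinearIndependent.pair_iff] at h ⊢
  intro s t hst
  refine h s t ?_
  refine LinearMap.ext fun y => ?_
  have sA := (isSymm_toBilin' hA).eq z y
  have sB := (isSymm_toBilin' hB).eq z y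
  have := congrArg (fun v => y ⬝ᵥ v) hst
  simpa [sA, sB, Matrix.toBilin'_apply', dotProduct_add, dotProduct_smul] using this

lemma rank_le_finrank_range_toBilin' {A : Matrix (Fin n) (Fin n) ℝ} (hA : A.IsSymm) :
    A.rank ≤ Module.finrank ℝ (LinearMap.range (Matrix.toBilin' A)) := by
  have hker : LinearMap.ker (Matrix.toBilin' A) ≤ LinearMap.ker A.mulVecLin := by
    intro x hx
    rw [LinearMap.mem_ker] at hx ⊢
    refine dotProduct_eq_zero _ fun y => ?_
    have := (isSymm_toBilin' hA).eq x y
    rw [hx, Matrix.toBilin'_apply'] at this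
    rw [dotProduct_comm]
    simpa using this.symm
  have h1 := Submodule.finrank_mono hker
  have h2 := LinearMap.finrank_range_add_finrank_ker A.mulVecLin
  have h3 := LinearMap.finrank_range_add_finrank_ker (Matrix.toBilin' A)
  rw [Matrix.rank]
  omega

/-- Isotropic vectors lie on the boundary of the cone as soon as the form is positive somewhere. -/
lemma mem_frontier_of_isotropic {A : Matrix (Fin n) (Fin n) ℝ} (hA : A.IsSymm)
    {p z : Fin n → ℝ} (hp : 0 < p ⬝ᵥ A.mulVec p) (hz : z ⬝ᵥ A.mulVec z = 0) :
    z ∈ frontier {x : Fin n → ℝ | x ⬝ᵥ A.mulVec x ≤ 0} := by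
  wlog hzp : 0 ≤ Matrix.toBilin' A z p generalizing p
  · refine this (p := -p) (by simpa [mulVec_neg] using hp) ?_
    simp only [map_neg]
    linarith
  rw [(isClosed_le (continuous_dotProduct_mulVec_self A) continuous_const).frontier_eq]
  refine ⟨hz.le, fun hint => ?_⟩
  have hc : Continuous fun t : ℝ => z + t • p := by fun_prop
  have hev : ∀ᶠ t : ℝ in nhds 0, z + t • p ∈ {x : Fin n → ℝ | x ⬝ᵥ A.mulVec x ≤ 0} :=
    hc.continuousAt.preimage_mem_nhds
      (by rw [zero_smul, add_zero]; exact mem_interior_iff_mem_nhds.1 hint)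
  obtain ⟨t, ht, ht0⟩ := ((hev.filter_mono nhdsWithin_le_nhds).and
    (self_mem_nhdsWithin (s := Set.Ioi 0))).exists
  have ht0 : 0 < t := ht0
  have h1 := bilinForm_add_smul_self (isSymm_toBilin' hA) z p t
  simp only [Matrix.toBilin'_apply', hz] at h1 hzp
  have ht : (z + t • p) ⬝ᵥ A.mulVec (z + t • p) ≤ 0 := ht
  have : 0 < t ^ 2 * (p ⬝ᵥ A.mulVec p) := by positivity
  have : 0 ≤ 2 * t * (z ⬝ᵥ A.mulVec p) := by positivity
  linarith

lemma exists_pos_of_mem_frontier {A : Matrix (Fin n) (Fin n) ℝ} {z : Fin n → ℝ}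
    (hz : z ∈ frontier {x : Fin n → ℝ | x ⬝ᵥ A.mulVec x ≤ 0}) :
    ∃ p : Fin n → ℝ, 0 < p ⬝ᵥ A.mulVec p := by
  by_contra! H
  rw [Set.eq_univ_of_forall (s := {x : Fin n → ℝ | x ⬝ᵥ A.mulVec x ≤ 0}) H] at hz
  simp at hz

lemma exists_neg_of_mem_frontier {A : Matrix (Fin n) (Fin n) ℝ} (hA : A.IsSymm) {z : Fin n → ℝ}
    (hz : z ∈ frontier {x : Fin n → ℝ | x ⬝ᵥ A.mulVec x ≤ 0}) (hAz : A.mulVec z ≠ 0) :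
    ∃ p : Fin n → ℝ, p ⬝ᵥ A.mulVec p < 0 := by
  have hle : z ⬝ᵥ A.mulVec z ≤ 0 :=
    (isClosed_le (continuous_dotProduct_mulVec_self A) continuous_const).frontier_subset hz
  by_contra! H
  have hzero : z ⬝ᵥ A.mulVec z = 0 := le_antisymm hle (H z)
  have hpos : 0 < A.mulVec z ⬝ᵥ A.mulVec z :=
    (dotProduct_self_star_nonneg (A.mulVec z)).lt_of_ne' (by simpa using hAz)
  obtain ⟨t, h1, ht⟩ := ((eventually_quadratic_pos
    (- (A.mulVec z ⬝ᵥ A.mulVec (A.mulVec z)) / 2) 0 (mul_pos two_pos hpos)).and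
      self_mem_nhdsWithin).exists
  have ht : 0 < t := ht
  have h2 := bilinForm_add_smul_self (isSymm_toBilin' hA) z (A.mulVec z) (-t)
  have hs := (isSymm_toBilin' hA).eq z (A.mulVec z)
  simp only [Matrix.toBilin'_apply'] at hs
  simp only [Matrix.toBilin'_apply', hzero, hs] at h2
  have h3 := H (z + (-t) • A.mulVec z)
  rw [h2] at h3
  nlinarith [mul_pos ht h1]

lemma exists_pos_forall_entrywise_near {A : Matrix (Fin n) (Fin n) ℝ} {w w' : Fin n → ℝ}
    (hw : w ⬝ᵥ A.mulVec w < 0) (hw' : 0 < w' ⬝ᵥ A.mulVec w') :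
    ∃ δ > (0 : ℝ), ∀ B : Matrix (Fin n) (Fin n) ℝ, (∀ i j, |B i j - A i j| < δ) →
      w ⬝ᵥ B.mulVec w < 0 ∧ 0 < w' ⬝ᵥ B.mulVec w' := by
  have hc : ∀ x : Fin n → ℝ, Continuous fun M : Fin n → Fin n → ℝ =>
      x ⬝ᵥ (Matrix.of M).mulVec x := fun x => by
    simp only [dotProduct, mulVec, Matrix.of_apply]
    fun_prop
  have hopen := (isOpen_lt (hc w) (continuous_const (y := 0))).inter
    (isOpen_lt (continuous_const (y := 0)) (hc w'))
  obtain ⟨δ, hδ, hball⟩ := Metric.isOpen_iff.1 hopen (fun i j => A i j) ⟨hw, hw'⟩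
  refine ⟨δ, hδ, fun B hB => hball (a := fun i j => B i j) ?_⟩
  rw [Metric.mem_ball, dist_pi_lt_iff hδ]
  intro i
  rw [dist_pi_lt_iff hδ]
  intro j
  simpa [Real.dist_eq] using hB i j

end Cone

/-- **Corollary 2.8.** Let `W` be a nontrivial subspace of `Sym(n,ℝ)` and let
`A ∈ W` have maximal rank `r ≥ 3` in `W`. Assume `∂Γ_A` is an `(n−1)`-dimensional variety
(there is `z ∈ ∂Γ_A` with `Az ≠ 0`). Then there is `δ > 0` such that for every `B ∈ W` with
`‖B − A‖ < δ` (entrywise): if `∂Γ_B` is an `(n−1)`-dimensional variety and `∂Γ_A`, `∂Γ_B` do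
not intersect transversally anywhere, then `Γ_A ⊆ Γ_B` or `Γ_B ⊆ Γ_A`. -/
theorem cone_nested_of_no_transversal_perturb {n : ℕ}
    (W : Submodule ℝ (Matrix (Fin n) (Fin n) ℝ)) (hW : W ≠ ⊥)
    (hWsymm : ∀ F ∈ W, F.IsSymm)
    (A : Matrix (Fin n) (Fin n) ℝ) (hA : A ∈ W)
    (hmax : ∀ F ∈ W, F.rank ≤ A.rank)
    (hrank : 3 ≤ A.rank)
    (hvarA : ∃ z ∈ frontier {x : Fin n → ℝ | x ⬝ᵥ A.mulVec x ≤ 0}, A.mulVec z ≠ 0) :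
    ∃ δ > (0 : ℝ), ∀ B ∈ W, (∀ i j, |B i j - A i j| < δ) →
      (∃ z' ∈ frontier {x : Fin n → ℝ | x ⬝ᵥ B.mulVec x ≤ 0}, B.mulVec z' ≠ 0) →
      (∀ z ∈ frontier {x : Fin n → ℝ | x ⬝ᵥ A.mulVec x ≤ 0} ∩
             frontier {x : Fin n → ℝ | x ⬝ᵥ B.mulVec x ≤ 0},
        ¬ LinearIndependent ℝ ![A.mulVec z, B.mulVec z]) →
      ({x : Fin n → ℝ | x ⬝ᵥ A.mulVec x ≤ 0} ⊆ {x : Fin n → ℝ | x ⬝ᵥ B.mulVec x ≤ 0} ∨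
       {x : Fin n → ℝ | x ⬝ᵥ B.mulVec x ≤ 0} ⊆ {x : Fin n → ℝ | x ⬝ᵥ A.mulVec x ≤ 0}) := by
  obtain ⟨z₀, hz₀, hAz₀⟩ := hvarA
  have sA := hWsymm A hA
  obtain ⟨w, hw⟩ := exists_neg_of_mem_frontier sA hz₀ hAz₀
  obtain ⟨w', hw'⟩ := exists_pos_of_mem_frontier hz₀
  obtain ⟨δ, hδ, hnear⟩ := exists_pos_forall_entrywise_near hw hw'
  refine ⟨δ, hδ, fun B hBW hBA _ htrans => ?_⟩
  have sB := hWsymm B hBW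
  obtain ⟨hBw, hBw'⟩ := hnear B hBA
  by_contra! H
  obtain ⟨⟨x, hAx, hBx⟩, ⟨y, hBy, hAy⟩⟩ := H.imp Set.not_subset.1 Set.not_subset.1
  simp only [Set.mem_ofPred_eq, not_le] at hAx hBx hBy hAy
  have bA := isSymm_toBilin' sA
  have bB := isSymm_toBilin' sB
  have hno : NoTransversalZero (Matrix.toBilin' A) (Matrix.toBilin' B) := fun v hAv hBv hli => by
    rw [Matrix.toBilin'_apply'] at hAv hBv
    exact htrans v ⟨mem_frontier_of_isotropic sA hw' hAv, mem_frontier_of_isotropic sB hBw' hBv⟩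
      (linearIndependent_mulVec_of_toBilin' sA sB hli)
  simp only [← Matrix.toBilin'_apply'] at hw hw' hBw hBw' hAx hBx hBy hAy
  obtain ⟨z, hz, hBz⟩ := exists_isotropic_pos bA bB hAx hw' hBx hBw'.le
  obtain ⟨z', hz', hBz'⟩ := exists_isotropic_pos bA bB.neg hw.le hAy
    (by simpa using hBw) (by simpa using hBy)
  obtain ⟨z, z', hz, hz', hzz', hBz, hBz'⟩ :=
    hno.exists_isotropic_pair bA bB hw hw' hz hz' hBz (by simpa using hBz')
  have h1 := hno.finrank_range_le_two bA bB hz hz' hzz' hBz hBz'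
  have h2 := rank_le_finrank_range_toBilin' sA
  omega
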